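/- Let G be a free group with free basis a₁, …, aₙ, H a free group, and φ, ψ : G → H homomorphisms. Suppose φ has remnant, there is exactly one index r with |Rem_φ(a_r)| = |a_rψ| while |Rem_φ(aᵢ)| > |aᵢψ| for all i ≠ r, and in addition a_rφ ≠ a_rψ. Then Eq(φ, ψ) = {1}. -/

import Mathlib

/-- The number of letters cancelled in the product `u * v` of elements of a free group:
`c(u,v) = (|u| + |v| - |uv|)/2`. -/
def cancel {κ : Type*} [DecidableEq κ] (u v : FreeGroup κ) : ℕ :=
  (FreeGroup.norm u + FreeGroup.norm v - FreeGroup.norm (u * v)) / 2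

/-- The basis letter indexed by `(i, ε)`: `of i` if `ε = true`, `(of i)⁻¹` if `ε = false`. -/
def bLetter {ι : Type*} (p : ι × Bool) : FreeGroup ι :=
  cond p.2 (FreeGroup.of p.1) (FreeGroup.of p.1)⁻¹

/-- `P_χ(x_i)`: maximal cancellation of `x_iχ` with the image of a basis letter `b ≠ x_i⁻¹`
multiplied on the left. -/
def Pc {ι κ : Type*} [Fintype ι] [DecidableEq ι] [DecidableEq κ]
    (χ : FreeGroup ι →* FreeGroup κ) (i : ι) : ℕ :=
  (Finset.univ.erase (i, false)).sup fun p => cancel (χ (bLetter p)) (χ (FreeGroup.of i))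

/-- `S_χ(x_i)`: maximal cancellation of `x_iχ` with the image of a basis letter `b ≠ x_i⁻¹`
multiplied on the right. -/
def Sc {ι κ : Type*} [Fintype ι] [DecidableEq ι] [DecidableEq κ]
    (χ : FreeGroup ι →* FreeGroup κ) (i : ι) : ℕ :=
  (Finset.univ.erase (i, false)).sup fun p => cancel (χ (FreeGroup.of i)) (χ (bLetter p))

/-- `χ` has remnant if for every basis element a nontrivial subword of its image survives
all the cancellations: `P_χ(x_i) + S_χ(x_i) < |x_iχ|`. -/
def HasRemnant {ι κ : Type*} [Fintype ι] [DecidableEq ι] [DecidableEq κ]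
    (χ : FreeGroup ι →* FreeGroup κ) : Prop :=
  ∀ i : ι, Pc χ i + Sc χ i < FreeGroup.norm (χ (FreeGroup.of i))

/-- The remnant length `|Rem_χ(x_i)| = |x_iχ| - P_χ(x_i) - S_χ(x_i)`. -/
def RemLen {ι κ : Type*} [Fintype ι] [DecidableEq ι] [DecidableEq κ]
    (χ : FreeGroup ι →* FreeGroup κ) (i : ι) : ℕ :=
  FreeGroup.norm (χ (FreeGroup.of i)) - Pc χ i - Sc χ i

theorem FreeGroup.exists_common_prefix {κ : Type*} [DecidableEq κ] (X Y : List (κ × Bool))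
    (hX : FreeGroup.IsReduced X) (hY : FreeGroup.IsReduced Y) :
    ∃ p s t, X = p ++ s ∧ Y = p ++ t ∧
      FreeGroup.norm ((FreeGroup.mk X)⁻¹ * FreeGroup.mk Y) = s.length + t.length := by
  induction X generalizing Y with
  | nil =>
    refine ⟨[], [], Y, rfl, rfl, ?_⟩
    simp [← FreeGroup.one_eq_mk, FreeGroup.norm, hY.reduce_eq]
  | cons a X ih =>
    cases Y with
    | nil =>
      refine ⟨[], a :: X, [], rfl, rfl, ?_⟩
      rw [← FreeGroup.one_eq_mk, mul_one, FreeGroup.norm_inv_eq, FreeGroup.norm,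
        FreeGroup.toWord_mk, hX.reduce_eq, List.length_nil, add_zero]
    | cons b Y =>
      by_cases hab : a = b
      · subst hab
        obtain ⟨p, s, t, h1, h2, h3⟩ := ih Y (hX.infix (List.suffix_cons a X).isInfix)
          (hY.infix (List.suffix_cons a Y).isInfix)
        refine ⟨a :: p, s, t, by simp [h1], by simp [h2], ?_⟩
        rw [← h3, show a :: X = [a] ++ X from rfl, show a :: Y = [a] ++ Y from rfl,
          ← FreeGroup.mul_mk, ← FreeGroup.mul_mk]
        congr 1
        group
      · refine ⟨[], a :: X, b :: Y, rfl, rfl, ?_⟩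
        have hred : FreeGroup.IsReduced (FreeGroup.invRev (a :: X) ++ b :: Y) := by
          have hX' : FreeGroup.IsReduced (FreeGroup.invRev (a :: X)) := by
            rw [FreeGroup.isReduced_iff_reduce_eq, FreeGroup.reduce_invRev, hX.reduce_eq]
          have hab' : FreeGroup.IsReduced ([(a.1, !a.2)] ++ b :: Y) := by
            rw [List.singleton_append, FreeGroup.isReduced_cons_cons]
            refine ⟨fun h => ?_, hY⟩
            have : a.2 ≠ b.2 := fun h' => hab (Prod.ext h h')
            revert this
            cases a.2 <;> cases b.2 <;> simp
          have hsplit : FreeGroup.invRev (a :: X) = FreeGroup.invRev X ++ [(a.1, !a.2)] := by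
            simp [FreeGroup.invRev]
          rw [hsplit] at hX' ⊢
          exact hX'.append_overlap hab' (by simp)
        rw [FreeGroup.inv_mk, FreeGroup.mul_mk, FreeGroup.norm, FreeGroup.toWord_mk,
          hred.reduce_eq, List.length_append, FreeGroup.invRev_length]

theorem FreeGroup.norm_inv_mul_add_le_iff {κ : Type*} [DecidableEq κ] (x y : FreeGroup κ)
    (n : ℕ) :
    FreeGroup.norm (x⁻¹ * y) + 2 * n ≤ FreeGroup.norm x + FreeGroup.norm y ↔
      n ≤ FreeGroup.norm x ∧ n ≤ FreeGroup.norm y ∧ x.toWord.take n = y.toWord.take n := by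
  constructor
  · obtain ⟨p, s, t, h1, h2, h3⟩ := FreeGroup.exists_common_prefix x.toWord y.toWord
      FreeGroup.isReduced_toWord FreeGroup.isReduced_toWord
    rw [FreeGroup.mk_toWord, FreeGroup.mk_toWord] at h3
    intro h
    have hx : FreeGroup.norm x = p.length + s.length := by
      rw [FreeGroup.norm, h1, List.length_append]
    have hy : FreeGroup.norm y = p.length + t.length := by
      rw [FreeGroup.norm, h2, List.length_append]
    have hn : n ≤ p.length := by omega
    refine ⟨by omega, by omega, ?_⟩
    rw [h1, h2, List.take_append_of_le_length hn, List.take_append_of_le_length hn]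
  · rintro ⟨hx, hy, h⟩
    have key : x⁻¹ * y =
        (FreeGroup.mk (x.toWord.drop n))⁻¹ * FreeGroup.mk (y.toWord.drop n) := by
      conv_lhs => rw [← FreeGroup.mk_toWord (x := x), ← FreeGroup.mk_toWord (x := y),
        ← List.take_append_drop n x.toWord, ← List.take_append_drop n y.toWord, h,
        ← FreeGroup.mul_mk, ← FreeGroup.mul_mk]
      group
    have h1 := FreeGroup.norm_mul_le (FreeGroup.mk (x.toWord.drop n))⁻¹
      (FreeGroup.mk (y.toWord.drop n))
    rw [← key, FreeGroup.norm_inv_eq] at h1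
    have h2 := FreeGroup.norm_mk_le (L₁ := x.toWord.drop n)
    have h3 := FreeGroup.norm_mk_le (L₁ := y.toWord.drop n)
    rw [List.length_drop] at h2 h3
    simp only [FreeGroup.norm] at *
    omega

theorem norm_mul_add_two_mul_cancel {κ : Type*} [DecidableEq κ] (u v : FreeGroup κ) :
    FreeGroup.norm (u * v) + 2 * cancel u v = FreeGroup.norm u + FreeGroup.norm v := by
  obtain ⟨p, s, t, h1, h2, h3⟩ := FreeGroup.exists_common_prefix u⁻¹.toWord v.toWord
    FreeGroup.isReduced_toWord FreeGroup.isReduced_toWord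
  rw [FreeGroup.mk_toWord, FreeGroup.mk_toWord, inv_inv] at h3
  have hu : FreeGroup.norm u = p.length + s.length := by
    rw [← FreeGroup.norm_inv_eq, FreeGroup.norm, h1, List.length_append]
  have hv : FreeGroup.norm v = p.length + t.length := by
    rw [FreeGroup.norm, h2, List.length_append]
  rw [cancel]
  omega

theorem cancel_inv_inv {κ : Type*} [DecidableEq κ] (u v : FreeGroup κ) :
    cancel v⁻¹ u⁻¹ = cancel u v := by
  rw [cancel, cancel, ← mul_inv_rev, FreeGroup.norm_inv_eq, FreeGroup.norm_inv_eq,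
    FreeGroup.norm_inv_eq, add_comm]

/-- If the cancellations at the two ends of `v` do not overlap, the left one is not affected by
multiplying `v` on the right. -/
theorem cancel_mul_le {κ : Type*} [DecidableEq κ] (u v w : FreeGroup κ)
    (h : cancel u v + cancel v w < FreeGroup.norm v) :
    cancel u (v * w) ≤ cancel u v := by
  by_contra! hlt
  have huv := norm_mul_add_two_mul_cancel u v
  have hvw := norm_mul_add_two_mul_cancel v w
  have huvw := norm_mul_add_two_mul_cancel u (v * w)
  have h1 := (FreeGroup.norm_inv_mul_add_le_iff u⁻¹ (v * w) (cancel u v + 1)).1 (by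
    rw [inv_inv, FreeGroup.norm_inv_eq]; omega)
  have h2 := (FreeGroup.norm_inv_mul_add_le_iff v (v * w) (cancel u v + 1)).1 (by
    rw [inv_mul_cancel_left]; omega)
  have h3 := (FreeGroup.norm_inv_mul_add_le_iff u⁻¹ v (cancel u v + 1)).2
    ⟨h1.1, h2.1, h1.2.2.trans h2.2.2.symm⟩
  rw [inv_inv, FreeGroup.norm_inv_eq] at h3
  omega

theorem bLetter_not {ι : Type*} (p : ι × Bool) : bLetter (p.1, !p.2) = (bLetter p)⁻¹ := by
  obtain ⟨i, _ | _⟩ := p <;> simp [bLetter]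

theorem mk_cons_eq_bLetter_mul {ι : Type*} (p : ι × Bool) (L : List (ι × Bool)) :
    FreeGroup.mk (p :: L) = bLetter p * FreeGroup.mk L := by
  obtain ⟨i, _ | _⟩ := p <;>
    simp [bLetter, FreeGroup.of, FreeGroup.inv_mk, FreeGroup.invRev, FreeGroup.mul_mk]

theorem norm_map_bLetter {ι κ : Type*} [DecidableEq κ] (χ : FreeGroup ι →* FreeGroup κ)
    (p : ι × Bool) :
    FreeGroup.norm (χ (bLetter p)) = FreeGroup.norm (χ (FreeGroup.of p.1)) := by
  obtain ⟨i, _ | _⟩ := p <;> simp [bLetter, FreeGroup.norm_inv_eq]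

theorem norm_map_mk_le {ι κ : Type*} [DecidableEq κ] (χ : FreeGroup ι →* FreeGroup κ)
    (L : List (ι × Bool)) :
    FreeGroup.norm (χ (FreeGroup.mk L)) ≤
      (L.map fun p => FreeGroup.norm (χ (FreeGroup.of p.1))).sum := by
  induction L with
  | nil => simp [← FreeGroup.one_eq_mk]
  | cons a L ih =>
    rw [mk_cons_eq_bLetter_mul, map_mul, List.map_cons, List.sum_cons]
    have := FreeGroup.norm_mul_le (χ (bLetter a)) (χ (FreeGroup.mk L))
    rw [norm_map_bLetter] at this
    omega

/-- The maximal cancellation on the left of the image of a letter in a reduced word. -/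
def leftCancel {ι κ : Type*} [Fintype ι] [DecidableEq ι] [DecidableEq κ]
    (χ : FreeGroup ι →* FreeGroup κ) (p : ι × Bool) : ℕ :=
  cond p.2 (Pc χ p.1) (Sc χ p.1)

theorem cancel_le_leftCancel {ι κ : Type*} [Fintype ι] [DecidableEq ι] [DecidableEq κ]
    (χ : FreeGroup ι →* FreeGroup κ) (q p : ι × Bool) (h : q.1 = p.1 → q.2 = p.2) :
    cancel (χ (bLetter q)) (χ (bLetter p)) ≤ leftCancel χ p := by
  obtain ⟨i, _ | _⟩ := p
  · rw [← cancel_inv_inv, ← map_inv, ← map_inv, ← bLetter_not q]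
    have hq : (q.1, !q.2) ∈ Finset.univ.erase (i, false) := by
      simpa using h
    simpa [leftCancel, bLetter, Sc] using
      Finset.le_sup (f := fun p => cancel (χ (FreeGroup.of i)) (χ (bLetter p))) hq
  · have hq : q ∈ Finset.univ.erase (i, false) := by
      obtain ⟨j, _ | _⟩ := q <;> simp_all
    simpa [leftCancel, bLetter, Pc] using
      Finset.le_sup (f := fun p => cancel (χ (bLetter p)) (χ (FreeGroup.of i))) hq

theorem cancel_le_leftCancel_not {ι κ : Type*} [Fintype ι] [DecidableEq ι] [DecidableEq κ]
    (χ : FreeGroup ι →* FreeGroup κ) (q p : ι × Bool) (h : q.1 = p.1 → q.2 = p.2) :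
    cancel (χ (bLetter q)) (χ (bLetter p)) ≤ leftCancel χ (q.1, !q.2) := by
  rw [← cancel_inv_inv, ← map_inv, ← map_inv, ← bLetter_not, ← bLetter_not]
  exact cancel_le_leftCancel χ _ _ fun h' => congrArg Bool.not (h h'.symm).symm

theorem HasRemnant.norm_eq {ι κ : Type*} [Fintype ι] [DecidableEq ι] [DecidableEq κ]
    {χ : FreeGroup ι →* FreeGroup κ} (hχ : HasRemnant χ) (p : ι × Bool) :
    FreeGroup.norm (χ (bLetter p)) =
      RemLen χ p.1 + leftCancel χ p + leftCancel χ (p.1, !p.2) ∧ 0 < RemLen χ p.1 := by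
  have := hχ p.1
  rw [norm_map_bLetter]
  obtain ⟨i, _ | _⟩ := p <;> simp only [leftCancel, RemLen, cond, Bool.not] at * <;> omega

theorem HasRemnant.cancel_and_norm {ι κ : Type*} [Fintype ι] [DecidableEq ι] [DecidableEq κ]
    {χ : FreeGroup ι →* FreeGroup κ} (hχ : HasRemnant χ) (L : List (ι × Bool)) (b : ι × Bool)
    (hL : FreeGroup.IsReduced (b :: L)) :
    (∀ q : ι × Bool, (q.1 = b.1 → q.2 = b.2) →
      cancel (χ (bLetter q)) (χ (FreeGroup.mk (b :: L))) ≤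
        cancel (χ (bLetter q)) (χ (bLetter b))) ∧
    ((b :: L).map fun p => RemLen χ p.1).sum + leftCancel χ b ≤
      FreeGroup.norm (χ (FreeGroup.mk (b :: L))) := by
  have hb := hχ.norm_eq b
  induction L generalizing b with
  | nil =>
    rw [mk_cons_eq_bLetter_mul, ← FreeGroup.one_eq_mk, mul_one]
    refine ⟨fun _ _ => le_rfl, ?_⟩
    simp only [List.map_cons, List.map_nil, List.sum_cons, List.sum_nil]
    omega
  | cons c L ih =>
    rw [FreeGroup.isReduced_cons_cons] at hL
    obtain ⟨ih1, ih2⟩ := ih c hL.2 (hχ.norm_eq c)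
    have hbc := ih1 b hL.1
    have hl := cancel_le_leftCancel χ b c hL.1
    have hr := cancel_le_leftCancel_not χ b c hL.1
    rw [mk_cons_eq_bLetter_mul b, map_mul]
    refine ⟨fun q hq => cancel_mul_le _ _ _ ?_, ?_⟩
    · have := cancel_le_leftCancel χ q b hq
      omega
    · have := norm_mul_add_two_mul_cancel (χ (bLetter b)) (χ (FreeGroup.mk (c :: L)))
      rw [List.map_cons, List.sum_cons]
      omega

theorem HasRemnant.sum_remLen_le_norm {ι κ : Type*} [Fintype ι] [DecidableEq ι] [DecidableEq κ]
    {χ : FreeGroup ι →* FreeGroup κ} (hχ : HasRemnant χ) (L : List (ι × Bool))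
    (hL : FreeGroup.IsReduced L) :
    (L.map fun p => RemLen χ p.1).sum ≤ FreeGroup.norm (χ (FreeGroup.mk L)) := by
  cases L with
  | nil => simp
  | cons b L => exact (Nat.le_add_right _ _).trans (hχ.cancel_and_norm L b hL).2

theorem mk_mem_zpowers_of_forall {ι : Type*} (r : ι) (L : List (ι × Bool))
    (h : ∀ p ∈ L, p.1 = r) :
    FreeGroup.mk L ∈ Subgroup.zpowers (FreeGroup.of r) := by
  induction L with
  | nil => exact one_mem _
  | cons a L ih =>
    rw [mk_cons_eq_bLetter_mul]
    refine mul_mem ?_ (ih fun p hp => h p (List.mem_cons_of_mem _ hp))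
    have ha := h a List.mem_cons_self
    obtain ⟨i, _ | _⟩ := a <;> simp_all [bLetter]

/-- Proposition 3.13: suppose `φ` has remnant, there is exactly one index `r` with
`|Rem_φ(a_r)| = |a_rψ|` while `|Rem_φ(aᵢ)| > |aᵢψ|` for all `i ≠ r`, and moreover
`a_rφ ≠ a_rψ`. Then `Eq(φ, ψ) = {1}`. -/
theorem equalizer_trivial_of_remnant_one_equality {n : ℕ} {κ : Type*} [DecidableEq κ]
    (φ ψ : FreeGroup (Fin n) →* FreeGroup κ)
    (hrem : HasRemnant φ) (r : Fin n)
    (heq : RemLen φ r = FreeGroup.norm (ψ (FreeGroup.of r)))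
    (hgt : ∀ i : Fin n, i ≠ r → FreeGroup.norm (ψ (FreeGroup.of i)) < RemLen φ i)
    (hne : φ (FreeGroup.of r) ≠ ψ (FreeGroup.of r)) :
    {g : FreeGroup (Fin n) | φ g = ψ g} = {1} := by
  ext g
  simp only [Set.mem_ofPred_eq, Set.mem_singleton_iff]
  refine ⟨fun hg => ?_, fun hg => by rw [hg, map_one, map_one]⟩
  have hall : ∀ p ∈ g.toWord, p.1 = r := by
    by_contra! hex
    obtain ⟨p, hp, hpr⟩ := hex
    have hlt : (g.toWord.map fun p => FreeGroup.norm (ψ (FreeGroup.of p.1))).sum <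
        (g.toWord.map fun p => RemLen φ p.1).sum := by
      refine List.sum_lt_sum _ _ (fun q _ => ?_) ⟨p, hp, hgt p.1 hpr⟩
      by_cases hq : q.1 = r
      · rw [hq, heq]
      · exact (hgt q.1 hq).le
    have h1 := hrem.sum_remLen_le_norm g.toWord FreeGroup.isReduced_toWord
    have h2 := norm_map_mk_le ψ g.toWord
    rw [FreeGroup.mk_toWord] at h1 h2
    rw [hg] at h1
    omega
  obtain ⟨z, hz⟩ := Subgroup.mem_zpowers_iff.1 (mk_mem_zpowers_of_forall r g.toWord hall)
  rw [FreeGroup.mk_toWord] at hz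
  by_cases hz0 : z = 0
  · rw [← hz, hz0, zpow_zero]
  · rw [← hz, map_zpow, map_zpow] at hg
    exact absurd ((zpow_left_inj hz0).1 hg) hne
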